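/- arXiv:0808.2543 — 2 statements merged into one kernel-verified Lean document; each statement's English description precedes it below -/
import Mathlib

section
/- Let (H,σ) be a difference field of characteristic zero with K := const(H,σ), and let H(t) be a ΠΣ*-extension of (H,σ) with σ(t) = α·t + β. Let f₁,…,f_n ∈ H(t) and write f_i = h_i + p_i where p_i ∈ H[t] and h_i is a proper fraction in t over H. Let c₁,…,c_n ∈ K, let g' ∈ H[t], let ρ ∈ H(t) be a proper fraction in t over H, and set g := ρ + g'. Then σ(g) − g = c₁·f₁ + … + c_n·f_n if and only if both σ(ρ) − ρ = c₁·h₁ + … + c_n·h_n and σ(g') − g' = c₁·p₁ + … + c_n·p_n. -/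
/-- `H(t)`: the subfield generated by the subfield `H` and the element `t`. -/
def adj {E : Type*} [Field E] (H : Subfield E) (t : E) : Subfield E :=
  Subfield.closure ((H : Set E) ∪ {t})

/-- The set of constants of the subfield `H` with respect to the automorphism `σ`. -/
def constSet {E : Type*} [Field E] (σ : E ≃+* E) (H : Subfield E) : Set E :=
  {c : E | c ∈ H ∧ σ c = c}

/-- A polynomial with all coefficients in the subfield `H`. -/
def polyOver {E : Type*} [Field E] (H : Subfield E) (P : Polynomial E) : Prop :=
  ∀ n, P.coeff n ∈ H

/-- `g ∈ H[t]`: `g` is a polynomial expression in `t` with coefficients in `H`. -/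
def isPolyIn {E : Type*} [Field E] (H : Subfield E) (t g : E) : Prop :=
  ∃ P : Polynomial E, polyOver H P ∧ g = Polynomial.eval t P

/-- `g` is a proper fraction in `t` over `H`: `g = U(t)/V(t)` with `deg U < deg V`. -/
def isProperFrac {E : Type*} [Field E] (H : Subfield E) (t g : E) : Prop :=
  ∃ U V : Polynomial E, polyOver H U ∧ polyOver H V ∧ U.degree < V.degree ∧
    g = Polynomial.eval t U / Polynomial.eval t V

open Polynomial in
/-- Polynomials with all coefficients in `H` are the images of polynomials over `H`. -/
theorem polyOver_iff_exists_map {E : Type*} [Field E] {H : Subfield E} {P : E[X]} :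
    polyOver H P ↔ ∃ Q : H[X], Q.map (algebraMap H E) = P := by
  constructor
  · intro hP
    obtain ⟨Q, hQ⟩ := (Polynomial.mem_lifts P).1 <|
      (Polynomial.lifts_iff_coeff_lifts (f := algebraMap H E) P).2 fun n => ⟨⟨_, hP n⟩, rfl⟩
    exact ⟨Q, hQ⟩
  · rintro ⟨Q, rfl⟩ n
    rw [coeff_map]
    exact (Q.coeff n).2

open Polynomial in
theorem isPolyIn_iff {E : Type*} [Field E] {H : Subfield E} {t g : E} :
    isPolyIn H t g ↔ ∃ P : H[X], g = aeval t P := by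
  simp [isPolyIn, polyOver_iff_exists_map, eval_map_algebraMap]

open Polynomial in
theorem isProperFrac_iff {E : Type*} [Field E] {H : Subfield E} {t g : E} :
    isProperFrac H t g ↔
      ∃ U V : H[X], U.degree < V.degree ∧ g = aeval t U / aeval t V := by
  constructor
  · rintro ⟨U, V, hU, hV, hlt, rfl⟩
    obtain ⟨U, rfl⟩ := polyOver_iff_exists_map.1 hU
    obtain ⟨V, rfl⟩ := polyOver_iff_exists_map.1 hV
    exact ⟨U, V, by simpa using hlt, by simp [eval_map_algebraMap]⟩
  · rintro ⟨U, V, hlt, rfl⟩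
    exact ⟨U.map (algebraMap H E), V.map (algebraMap H E), polyOver_iff_exists_map.2 ⟨U, rfl⟩,
      polyOver_iff_exists_map.2 ⟨V, rfl⟩, by simpa using hlt, by simp [eval_map_algebraMap]⟩

theorem isPolyIn.sub {E : Type*} [Field E] {H : Subfield E} {t x y : E}
    (hx : isPolyIn H t x) (hy : isPolyIn H t y) : isPolyIn H t (x - y) := by
  rw [isPolyIn_iff] at *
  obtain ⟨P, rfl⟩ := hx
  obtain ⟨Q, rfl⟩ := hy
  exact ⟨P - Q, by simp⟩

theorem isPolyIn.sum_mul {E : Type*} [Field E] {H : Subfield E} {t : E} {ι : Type*}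
    {s : Finset ι} {c x : ι → E} (hc : ∀ i, c i ∈ H) (hx : ∀ i, isPolyIn H t (x i)) :
    isPolyIn H t (∑ i ∈ s, c i * x i) := by
  simp only [isPolyIn_iff] at *
  choose P hP using hx
  refine ⟨∑ i ∈ s, Polynomial.C ⟨c i, hc i⟩ * P i, ?_⟩
  simp only [map_sum, map_mul, Polynomial.aeval_C, hP]
  rfl

theorem isProperFrac_zero {E : Type*} [Field E] {H : Subfield E} {t : E} :
    isProperFrac H t 0 :=
  isProperFrac_iff.2 ⟨0, 1, by simp, by simp⟩

theorem isProperFrac.mul_left {E : Type*} [Field E] {H : Subfield E} {t c x : E}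
    (hc : c ∈ H) (hx : isProperFrac H t x) : isProperFrac H t (c * x) := by
  rw [isProperFrac_iff] at *
  obtain ⟨U, V, hlt, rfl⟩ := hx
  refine ⟨(⟨c, hc⟩ : H) • U, V, (Polynomial.degree_smul_le _ _).trans_lt hlt, ?_⟩
  rw [map_smul, mul_div_assoc', Algebra.smul_def]
  rfl

open Polynomial in
theorem isProperFrac.add {E : Type*} [Field E] {H : Subfield E} {t x y : E}
    (ht : Transcendental H t) (hx : isProperFrac H t x) (hy : isProperFrac H t y) :
    isProperFrac H t (x + y) := by
  rw [isProperFrac_iff] at *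
  obtain ⟨U, V, hUV, rfl⟩ := hx
  obtain ⟨A, B, hAB, rfl⟩ := hy
  have hV0 : V ≠ 0 := ne_zero_of_degree_gt hUV
  have hB0 : B ≠ 0 := ne_zero_of_degree_gt hAB
  have hV : aeval t V ≠ 0 := fun h => hV0 (transcendental_iff.1 ht V h)
  have hB : aeval t B ≠ 0 := fun h => hB0 (transcendental_iff.1 ht B h)
  refine ⟨U * B + V * A, V * B, (degree_add_le _ _).trans_lt (max_lt ?_ ?_), ?_⟩
  · rw [degree_mul, degree_mul]
    exact WithBot.add_lt_add_right (degree_ne_bot.2 hB0) hUV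
  · rw [degree_mul, degree_mul]
    exact WithBot.add_lt_add_left (degree_ne_bot.2 hV0) hAB
  · rw [div_add_div _ _ hV hB]
    simp

theorem isProperFrac.sub {E : Type*} [Field E] {H : Subfield E} {t x y : E}
    (ht : Transcendental H t) (hx : isProperFrac H t x) (hy : isProperFrac H t y) :
    isProperFrac H t (x - y) := by
  rw [sub_eq_add_neg, neg_eq_neg_one_mul]
  exact hx.add ht (hy.mul_left (neg_mem (one_mem H)))

theorem isProperFrac.sum_mul {E : Type*} [Field E] {H : Subfield E} {t : E} {ι : Type*}
    {s : Finset ι} {c x : ι → E} (ht : Transcendental H t) (hc : ∀ i, c i ∈ H)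
    (hx : ∀ i, isProperFrac H t (x i)) : isProperFrac H t (∑ i ∈ s, c i * x i) :=
  Finset.sum_induction _ _ (fun _ _ ha hb => ha.add ht hb) isProperFrac_zero
    fun i _ => (hx i).mul_left (hc i)

open Polynomial in
/-- Only zero is both a proper fraction and a polynomial in a transcendental element. -/
theorem isProperFrac.eq_zero_of_isPolyIn {E : Type*} [Field E] {H : Subfield E} {t x : E}
    (ht : Transcendental H t) (hx : isProperFrac H t x) (hp : isPolyIn H t x) : x = 0 := by
  obtain ⟨U, V, hUV, hxUV⟩ := isProperFrac_iff.1 hx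
  obtain ⟨P, rfl⟩ := isPolyIn_iff.1 hp
  have hV0 : V ≠ 0 := ne_zero_of_degree_gt hUV
  have hV : aeval t V ≠ 0 := fun h => hV0 (transcendental_iff.1 ht V h)
  have hPV : P * V = U := by
    apply transcendental_iff_injective.1 ht
    rw [map_mul, hxUV, div_mul_cancel₀ _ hV]
  have hP : P = 0 := by
    by_contra hP
    exact absurd (hPV ▸ hUV) (not_lt.2 (degree_le_mul_left V hP |>.trans_eq (by rw [mul_comm])))
  simp [hP]

open Polynomial in
/-- An automorphism preserving `H` with `σ t = α * t + β` acts on `H[t]` degree by degree. -/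
theorem exists_degree_eq_and_map_aeval {E : Type*} [Field E] {σ : E ≃+* E} {H : Subfield E}
    (hH : ∀ x ∈ H, σ x ∈ H) {t α β : E} (hα : α ∈ H) (hβ : β ∈ H) (hα0 : α ≠ 0)
    (hσt : σ t = α * t + β) (P : H[X]) :
    ∃ Q : H[X], Q.degree = P.degree ∧ σ (aeval t P) = aeval t Q := by
  let τ : H →+* H := ((σ : E →+* E).comp H.subtype).codRestrict H fun x => hH x x.2
  have ha : (⟨α, hα⟩ : H) ≠ 0 := fun h => hα0 (congrArg Subtype.val h)
  refine ⟨(P.map τ).comp (C ⟨α, hα⟩ * X + C ⟨β, hβ⟩), ?_, ?_⟩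
  · rw [degree_comp, degree_linear ha, mul_one]
    · exact degree_map P τ
    · rw [degree_linear ha]
      exact zero_lt_one
  · rw [aeval_comp]
    simp only [map_add, map_mul, aeval_C, aeval_X]
    change σ (aeval t P) = aeval (α * t + β) (P.map τ)
    rw [← hσt, aeval_def, aeval_def, eval₂_map]
    exact hom_eval₂ P (algebraMap H E) (σ : E →+* E) t

/-- Splitting of parameterized telescoping into a rational part and a polynomial part:
with `fᵢ = hᵢ + pᵢ` (proper fraction plus polynomial part) and `g = ρ + g'`,
`σ(g) - g = Σ cᵢ·fᵢ` holds iff `σ(ρ) - ρ = Σ cᵢ·hᵢ` and `σ(g') - g' = Σ cᵢ·pᵢ`. -/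
theorem split_telescoping {E : Type*} [Field E] [CharZero E] (σ : E ≃+* E)
    (H : Subfield E) (hH : H.map (σ : E →+* E) = H)
    -- H(t) is a ΠΣ*-extension of H with σ(t) = α·t + β
    (t α β : E) (hα : α ∈ H) (hβ : β ∈ H) (hα0 : α ≠ 0)
    (hσt : σ t = α * t + β)
    (htrans : Transcendental H t)
    (hconst : constSet σ (adj H t) = constSet σ H)
    (hPS : (α = 1 ∧ β ≠ 0) ∨ β = 0)
    -- the data
    (n : ℕ) (f h p : Fin n → E)
    (hsplit : ∀ i, f i = h i + p i)
    (hpol : ∀ i, isPolyIn H t (p i))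
    (hfrac : ∀ i, isProperFrac H t (h i))
    (c : Fin n → E) (hc : ∀ i, c i ∈ constSet σ H)
    (g' : E) (hg' : isPolyIn H t g')
    (ρ : E) (hρ : isProperFrac H t ρ)
    (g : E) (hg : g = ρ + g') :
    σ g - g = ∑ i, c i * f i ↔
      (σ ρ - ρ = ∑ i, c i * h i ∧ σ g' - g' = ∑ i, c i * p i) := by
  have hσH : ∀ x ∈ H, σ x ∈ H := fun x hx => hH.le (Subfield.mem_map.2 ⟨x, hx, rfl⟩)
  have hpoly {x : E} (hx : isPolyIn H t x) : isPolyIn H t (σ x) := by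
    obtain ⟨P, rfl⟩ := isPolyIn_iff.1 hx
    obtain ⟨Q, -, hQ⟩ := exists_degree_eq_and_map_aeval hσH hα hβ hα0 hσt P
    exact isPolyIn_iff.2 ⟨Q, hQ⟩
  have hproper {x : E} (hx : isProperFrac H t x) : isProperFrac H t (σ x) := by
    obtain ⟨U, V, hUV, rfl⟩ := isProperFrac_iff.1 hx
    obtain ⟨A, hA, hUA⟩ := exists_degree_eq_and_map_aeval hσH hα hβ hα0 hσt U
    obtain ⟨B, hB, hVB⟩ := exists_degree_eq_and_map_aeval hσH hα hβ hα0 hσt V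
    exact isProperFrac_iff.2 ⟨A, B, by rwa [hA, hB], by rw [map_div₀, hUA, hVB]⟩
  have hsum : ∑ i, c i * f i = ∑ i, c i * h i + ∑ i, c i * p i := by
    simp only [hsplit, mul_add, Finset.sum_add_distrib]
  rw [hsum, hg, map_add]
  constructor
  · intro heq
    have hxy : σ ρ - ρ - ∑ i, c i * h i = ∑ i, c i * p i - (σ g' - g') := by
      linear_combination heq
    have hx : isProperFrac H t (σ ρ - ρ - ∑ i, c i * h i) :=
      ((hproper hρ).sub htrans hρ).sub htrans (.sum_mul htrans (fun i => (hc i).1) hfrac)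
    have hy : isPolyIn H t (∑ i, c i * p i - (σ g' - g')) :=
      (isPolyIn.sum_mul (fun i => (hc i).1) hpol).sub ((hpoly hg').sub hg')
    have hx0 := hx.eq_zero_of_isPolyIn htrans (hxy ▸ hy)
    exact ⟨sub_eq_zero.1 hx0, (sub_eq_zero.1 (hxy ▸ hx0)).symm⟩
  · rintro ⟨h₁, h₂⟩
    linear_combination h₁ + h₂
end

section
/- Let (H,σ) be a difference field of characteristic zero with K := const(H,σ), and let H(t) be a ΠΣ*-extension of (H,σ). Let p₁,…,p_m ∈ H[t], say p_i = P_i(t) with P_i ∈ H[X], and set d := max(deg P₁, …, deg P_m, 1) (with the convention deg 0 = −1). Define b := d if H(t) is a Π-extension (σ(t)/t ∈ H) and b := d + 1 if H(t) is a Σ*-extension (σ(t) − t ∈ H). Then every g ∈ H[t] for which there exist c₁,…,c_m ∈ K with σ(g) − g = c₁·p₁ + … + c_m·p_m can be written g = Q(t) for some Q ∈ H[X] with deg Q ≤ b. -/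
open scoped Classical

namespace Polynomial

/-- The coefficient of `f(X + r)` one below a bound on the degree of `f`. -/
theorem taylor_coeff_of_natDegree_le_succ {K : Type*} [CommRing K] (r : K) (f : Polynomial K) {k : ℕ}
    (h : f.natDegree ≤ k + 1) :
    (taylor r f).coeff k = f.coeff k + (k + 1) * f.coeff (k + 1) * r := by
  have hd : (hasseDeriv k f).natDegree < 2 := by
    have := natDegree_hasseDeriv_le f k
    omega
  rw [taylor_coeff, eval_eq_sum_range' hd, Finset.sum_range_succ, Finset.sum_range_one]
  simp [hasseDeriv_coeff, add_comm 1 k]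

/-- `f` and `f(X + r)` have the same coefficient at a bound on the degree of `f`. -/
theorem taylor_coeff_of_natDegree_le {K : Type*} [CommRing K] (r : K) (f : Polynomial K) {k : ℕ}
    (h : f.natDegree ≤ k) : (taylor r f).coeff k = f.coeff k := by
  have hd : (hasseDeriv k f).natDegree < 1 := by
    have := natDegree_hasseDeriv_le f k
    omega
  rw [taylor_coeff, eval_eq_sum_range' hd, Finset.sum_range_one]
  simp [hasseDeriv_coeff]

end Polynomial

theorem polyOver.exists_map_eq {E : Type*} [Field E] {H : Subfield E} {P : Polynomial E}
    (hP : polyOver H P) : ∃ R : Polynomial H, R.map H.subtype = P := by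
  have : P ∈ Polynomial.lifts H.subtype :=
    (Polynomial.lifts_iff_coeff_lifts P).2 fun n => ⟨⟨_, hP n⟩, rfl⟩
  exact (Polynomial.mem_lifts P).1 this

theorem polyOver_map_subtype {E : Type*} [Field E] {H : Subfield E} (R : Polynomial H) :
    polyOver H (R.map H.subtype) := fun n => by
  rw [Polynomial.coeff_map]
  exact (R.coeff n).2

theorem eval_map_subtype_injective {E : Type*} [Field E] {H : Subfield E} {t : E}
    (ht : Transcendental H t) {R S : Polynomial H}
    (h : Polynomial.eval t (R.map H.subtype) = Polynomial.eval t (S.map H.subtype)) : R = S := by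
  apply transcendental_iff_injective.1 ht
  rw [Polynomial.aeval_def, Polynomial.aeval_def, Polynomial.eval₂_eq_eval_map,
    Polynomial.eval₂_eq_eval_map]
  exact h

/-- In an extension without new constants, a fixed polynomial expression is constant. -/
theorem natDegree_eq_zero_of_fixed {E : Type*} [Field E] {σ : E ≃+* E} {H : Subfield E} {t : E}
    (ht : Transcendental H t) (hconst : constSet σ (adj H t) = constSet σ H) {R : Polynomial H}
    (hR : σ (Polynomial.eval t (R.map H.subtype)) = Polynomial.eval t (R.map H.subtype)) :
    R.natDegree = 0 := by
  have hmem : Polynomial.eval t (R.map H.subtype) ∈ adj H t := by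
    rw [Polynomial.eval_map, Polynomial.eval₂_eq_sum_range]
    have htmem : t ∈ adj H t := Subfield.subset_closure (Or.inr rfl)
    have hHmem : ∀ x : H, (x : E) ∈ adj H t := fun x => Subfield.subset_closure (Or.inl x.2)
    exact sum_mem fun i _ => mul_mem (hHmem (R.coeff i)) (pow_mem htmem i)
  have hH : Polynomial.eval t (R.map H.subtype) ∈ constSet σ H := by
    rw [← hconst]
    exact ⟨hmem, hR⟩
  have : R = Polynomial.C ⟨_, hH.1⟩ := eval_map_subtype_injective ht (by simp)
  rw [this, Polynomial.natDegree_C]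

/-- Karr's degree bound: if `H(t)` is a ΠΣ*-extension with `σ(t) = α·t + β`
(`Π`-case: `β = 0`; `Σ*`-case: `α = 1`, `β ≠ 0`), `pᵢ = Pᵢ(t)` with coefficients
of `Pᵢ` in `H`, `d := max(deg P₁,…,deg P_m, 1)` with `deg 0 = ⊥`, and
`b := d` in the Π-case and `b := d + 1` in the Σ*-case, then every polynomial
solution `g ∈ H[t]` of `σ(g) - g = Σ cᵢ·pᵢ` can be written as `Q(t)` with
coefficients in `H` and `deg Q ≤ b`. -/
theorem degree_bound {E : Type*} [Field E] [CharZero E] (σ : E ≃+* E)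
    (H : Subfield E) (hH : H.map (σ : E →+* E) = H)
    (t α β : E) (hα : α ∈ H) (hβ : β ∈ H) (hα0 : α ≠ 0)
    (hσt : σ t = α * t + β)
    (htrans : Transcendental H t)
    (hconst : constSet σ (adj H t) = constSet σ H)
    (hPS : (α = 1 ∧ β ≠ 0) ∨ β = 0)
    (m : ℕ) (P : Fin m → Polynomial E) (hP : ∀ i, polyOver H (P i))
    (p : Fin m → E) (hp : ∀ i, p i = Polynomial.eval t (P i))
    (b : WithBot ℕ)
    (hb : b = if β = 0 then max (Finset.univ.sup fun i => (P i).degree) 1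
              else max (Finset.univ.sup fun i => (P i).degree) 1 + 1)
    (g : E) (hg : isPolyIn H t g)
    (c : Fin m → E) (hc : ∀ i, c i ∈ constSet σ H)
    (heq : σ g - g = ∑ i, c i * p i) :
    ∃ Q : Polynomial E, polyOver H Q ∧ g = Polynomial.eval t Q ∧ Q.degree ≤ b := by
  have hmaps : ∀ x ∈ H, σ x ∈ H := fun x hx => by
    rw [← hH]
    exact ⟨x, hx, rfl⟩
  let τ : H →+* H := ((σ : E →+* E).comp H.subtype).codRestrict H fun x => hmaps x x.2
  obtain ⟨Q', hQ', hgQ⟩ := hg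
  obtain ⟨Q, rfl⟩ := hQ'.exists_map_eq
  choose R hR using fun i => (hP i).exists_map_eq
  let α' : H := ⟨α, hα⟩
  let β' : H := ⟨β, hβ⟩
  have hσeval : ∀ S : Polynomial H, σ (Polynomial.eval t (S.map H.subtype)) = Polynomial.eval t
      (((S.map τ).comp (Polynomial.C α' * Polynomial.X + Polynomial.C β')).map H.subtype) := by
    intro S
    have hcomp : H.subtype.comp τ = (σ : E →+* E).comp H.subtype := rfl
    rw [Polynomial.map_comp, Polynomial.eval_comp, Polynomial.map_map, hcomp,
      ← Polynomial.map_map, Polynomial.eval_map (σ : E →+* E)]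
    have harg : Polynomial.eval t
        ((Polynomial.C α' * Polynomial.X + Polynomial.C β').map H.subtype) = σ t := by
      simp [hσt, α', β']
    rw [harg]
    exact (Polynomial.eval₂_at_apply (σ : E →+* E) t).symm
  let D : Polynomial H := ∑ i, Polynomial.C ⟨c i, (hc i).1⟩ * R i
  have hD : (Q.map τ).comp (Polynomial.C α' * Polynomial.X + Polynomial.C β') - Q = D := by
    apply eval_map_subtype_injective htrans
    rw [Polynomial.map_sub, Polynomial.eval_sub, ← hσeval, ← hgQ, heq]
    simp [D, Polynomial.map_sum, Polynomial.eval_finsetSum, hR, hp]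
  have hDcoeff : ∀ k : ℕ, (Finset.univ.sup fun i => (P i).degree) < k → D.coeff k = 0 := by
    intro k hk
    simp only [D, Polynomial.finsetSum_coeff, Polynomial.coeff_C_mul]
    refine Finset.sum_eq_zero fun i _ => ?_
    have hlt : (R i).degree < k := by
      rw [← Polynomial.degree_map (R i) H.subtype, hR]
      exact (Finset.le_sup (f := fun i => (P i).degree) (Finset.mem_univ i)).trans_lt hk
    rw [Polynomial.coeff_eq_zero_of_degree_lt hlt, mul_zero]
  refine ⟨_, hQ', hgQ, ?_⟩
  rw [Polynomial.degree_map]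
  by_contra! hlt
  have hQ0 : Q ≠ 0 := by
    rintro rfl
    simp at hlt
  rw [Polynomial.degree_eq_natDegree hQ0] at hlt
  have hlead : Q.coeff Q.natDegree ≠ 0 := Polynomial.leadingCoeff_ne_zero.2 hQ0
  by_cases hβ0 : β = 0
  · rw [hb, if_pos hβ0, max_lt_iff] at hlt
    have hn : 1 < Q.natDegree := by exact_mod_cast hlt.2
    have hβ' : β' = 0 := Subtype.ext hβ0
    have hfix := congrArg (Polynomial.coeff · Q.natDegree) hD
    simp only [hDcoeff _ hlt.1, hβ', Polynomial.C_0, add_zero, Polynomial.coeff_sub,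
      Polynomial.comp_C_mul_X_coeff, Polynomial.coeff_map, sub_eq_zero] at hfix
    have h0 := natDegree_eq_zero_of_fixed (σ := σ) htrans hconst
      (R := Polynomial.C (Q.coeff Q.natDegree) * Polynomial.X ^ Q.natDegree) (by
        rw [hσeval, hβ']
        congr 2
        simp only [Polynomial.map_mul, Polynomial.map_pow, Polynomial.map_C, Polynomial.map_X,
          Polynomial.mul_comp, Polynomial.pow_comp, Polynomial.C_comp, Polynomial.X_comp,
          Polynomial.C_0, add_zero, mul_pow, ← mul_assoc]
        rw [← Polynomial.C_pow, ← Polynomial.C_mul, hfix])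
    rw [Polynomial.natDegree_C_mul_X_pow _ _ hlead] at h0
    omega
  · have hα' : α' = 1 := Subtype.ext (hPS.resolve_right hβ0).1
    rw [hb, if_neg hβ0] at hlt
    obtain ⟨k, hk⟩ : ∃ k, Q.natDegree = k + 1 := by
      refine Nat.exists_eq_succ_of_ne_zero fun h0 => ?_
      rw [h0] at hlt
      have h1 : (1 : WithBot ℕ) + 1 < ((0 : ℕ) : WithBot ℕ) :=
        (add_le_add_left (le_max_right _ _) 1).trans_lt hlt
      exact absurd h1 (by decide)
    rw [hk, Nat.cast_add, Nat.cast_one] at hlt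
    have hlt' := lt_of_add_lt_add_right hlt
    rw [hk] at hlead
    have hsup := (le_max_left _ _).trans_lt hlt'
    have htaylor : ∀ S : Polynomial H,
        S.comp (Polynomial.C α' * Polynomial.X + Polynomial.C β') = Polynomial.taylor β' S := by
      intro S
      rw [hα', Polynomial.C_1, one_mul, Polynomial.taylor_apply]
    have hdeg : (Q.map τ).natDegree ≤ k + 1 := by rw [Polynomial.natDegree_map, hk]
    rw [htaylor] at hD
    have hfix := congrArg (Polynomial.coeff · (k + 1)) hD
    have hsub := congrArg (Polynomial.coeff · k) hD
    simp only [Polynomial.coeff_sub, Polynomial.taylor_coeff_of_natDegree_le _ _ hdeg,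
      hDcoeff _ (hsup.trans (by exact_mod_cast Nat.lt_succ_self k)), Polynomial.coeff_map,
      sub_eq_zero] at hfix
    simp only [Polynomial.coeff_sub, Polynomial.taylor_coeff_of_natDegree_le_succ _ _ hdeg,
      hDcoeff _ hsup, Polynomial.coeff_map, sub_eq_zero, hfix] at hsub
    have h0 := natDegree_eq_zero_of_fixed (σ := σ) htrans hconst
      (R := Polynomial.C ((k + 1) * Q.coeff (k + 1)) * Polynomial.X + Polynomial.C (Q.coeff k)) (by
        rw [hσeval, hα']
        congr 2
        simp only [Polynomial.map_mul, Polynomial.map_add, Polynomial.map_C, Polynomial.map_X,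
          Polynomial.mul_comp, Polynomial.add_comp, Polynomial.C_comp, Polynomial.X_comp,
          map_mul τ, map_add τ, map_natCast τ, map_one τ, hfix]
        simp only [Polynomial.C_mul, Polynomial.C_add, Polynomial.C_1]
        have := congrArg Polynomial.C hsub
        simp only [Polynomial.C_mul, Polynomial.C_add, Polynomial.C_1] at this
        linear_combination this)
    rw [Polynomial.natDegree_linear (mul_ne_zero (Nat.cast_add_one_ne_zero k) hlead)] at h0
    exact one_ne_zero h0
end
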